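/- arXiv:1503.02851 — 4 statements merged into one kernel-verified Lean document; each statement's English description precedes it below -/
import Mathlib

section
/- Let p be a prime with p ≡ 3 (mod 8) and p > 3. Then the class number of the imaginary quadratic field ℚ(√−p) is at most (p−1)/6. -/
open scoped QuadraticAlgebra

namespace QuadraticAlgebra

theorem four_mul_norm_neg_one {c : ℤ} (z : QuadraticAlgebra ℤ (-c) 1) :
    4 * z.norm = (2 * z.re + z.im) ^ 2 + (4 * c - 1) * z.im ^ 2 := by
  rw [norm_def]; ring

theorem norm_pos_of_ne_zero {c : ℤ} (hc : 0 < c) {z : QuadraticAlgebra ℤ (-c) 1} (hz : z ≠ 0) :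
    0 < z.norm := by
  have h := four_mul_norm_neg_one z
  have h1 : 0 < 4 * c - 1 := by omega
  by_cases him : z.im = 0
  · have hre : z.re ≠ 0 := fun hre => hz (QuadraticAlgebra.ext hre him)
    rw [him] at h
    have : 0 < z.re ^ 2 := by positivity
    linarith
  · have : 0 < (4 * c - 1) * z.im ^ 2 := by positivity
    nlinarith [sq_nonneg (2 * z.re + z.im)]

theorem eq_zero_of_mul_eq_zero_of_ne_zero {c : ℤ} (hc : 0 < c)
    {z x : QuadraticAlgebra ℤ (-c) 1} (hx : x ≠ 0) (h : z * x = 0) : z = 0 := by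
  by_contra hz
  have h1 := congrArg norm h
  rw [map_mul, norm_zero] at h1
  exact (mul_pos (norm_pos_of_ne_zero hc hz) (norm_pos_of_ne_zero hc hx)).ne' h1

theorem exists_mem_norm_minimal {c : ℤ} (hc : 0 < c) {I : Ideal (QuadraticAlgebra ℤ (-c) 1)}
    (hI : I ≠ ⊥) : ∃ x ∈ I, x ≠ 0 ∧ ∀ y ∈ I, y ≠ 0 → x.norm ≤ y.norm := by
  obtain ⟨x₀, hx₀, hne⟩ := Submodule.exists_mem_ne_zero_of_ne_bot hI
  obtain ⟨x, ⟨hx, hx0⟩, hmin⟩ := (measure fun z : QuadraticAlgebra ℤ (-c) 1 =>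
    z.norm.toNat).wf.has_min {z | z ∈ I ∧ z ≠ 0} ⟨x₀, hx₀, hne⟩
  refine ⟨x, hx, hx0, fun y hy hy0 => ?_⟩
  have h : ¬ y.norm.toNat < x.norm.toNat := hmin y ⟨hy, hy0⟩
  have := norm_pos_of_ne_zero hc hy0
  omega

theorem eq_intCast_mul_of_norm_minimal {c : ℤ} (hc : 0 < c)
    {I : Ideal (QuadraticAlgebra ℤ (-c) 1)} {x y : QuadraticAlgebra ℤ (-c) 1} (hx : x ∈ I)
    (hx0 : x ≠ 0) (hmin : ∀ z ∈ I, z ≠ 0 → x.norm ≤ z.norm) (hy : y ∈ I)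
    (him : (y * star x).im = 0) : ∃ q : ℤ, y = (q : QuadraticAlgebra ℤ (-c) 1) * x := by
  have hN := norm_pos_of_ne_zero hc hx0
  set u := (y * star x).re with hu
  refine ⟨u / x.norm, ?_⟩
  by_contra hne
  set z := y - ((u / x.norm : ℤ) : QuadraticAlgebra ℤ (-c) 1) * x with hz
  have hz0 : z ≠ 0 := sub_ne_zero.mpr hne
  have hzI : z ∈ I := I.sub_mem hy (I.mul_mem_left _ hx)
  have hprod : z * star x = ((u % x.norm : ℤ) : QuadraticAlgebra ℤ (-c) 1) := by
    have h1 : y * star x = (u : QuadraticAlgebra ℤ (-c) 1) :=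
      QuadraticAlgebra.ext (by simp [hu]) (by simpa using him)
    have h2 : x * star x = (x.norm : QuadraticAlgebra ℤ (-c) 1) := by
      rw [← algebraMap_norm_eq_mul_star]; rfl
    rw [hz, sub_mul, mul_assoc, h1, h2, Int.emod_def]
    push_cast
    ring
  have hnorm := congrArg norm hprod
  rw [map_mul, norm_star, norm_intCast, Int.cast_id] at hnorm
  have := hmin z hzI hz0
  have h3 := Int.emod_nonneg u hN.ne'
  have h4 := Int.emod_lt_of_pos u hN
  have h5 := mul_le_mul_of_nonneg_right this hN.le
  have h6 := pow_lt_pow_left₀ h4 h3 two_ne_zero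
  linarith [sq x.norm]

/-- Every nonzero ideal of the quadratic order of discriminant `1 - 4 * c < 0` has a
multiple of the form `(x) * (n, ω + m)` with `n` small. -/
theorem exists_span_mul_eq_span_mul_reduced {c : ℤ} (hc : 0 < c)
    {I : Ideal (QuadraticAlgebra ℤ (-c) 1)} (hI : I ≠ ⊥) :
    ∃ (n m : ℕ) (x : QuadraticAlgebra ℤ (-c) 1), x ≠ 0 ∧ m < n ∧ 3 * (n : ℤ) ^ 2 ≤ 4 * c - 1 ∧
      (n : ℤ) ∣ (m : ℤ) ^ 2 + m + c ∧
      Ideal.span {(n : QuadraticAlgebra ℤ (-c) 1)} * I =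
        Ideal.span {x} *
          Ideal.span {(n : QuadraticAlgebra ℤ (-c) 1), ω + (m : QuadraticAlgebra ℤ (-c) 1)} := by
  obtain ⟨x, hx, hx0, hmin⟩ := exists_mem_norm_minimal hc hI
  have hN := norm_pos_of_ne_zero hc hx0
  let φ : QuadraticAlgebra ℤ (-c) 1 →ₗ[ℤ] ℤ := imₗ (-c) 1 ∘ₗ LinearMap.mulRight ℤ (star x)
  have hφ (y : QuadraticAlgebra ℤ (-c) 1) : φ y = (y * star x).im := rfl
  have hφz (k : ℤ) (y : QuadraticAlgebra ℤ (-c) 1) :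
      φ ((k : QuadraticAlgebra ℤ (-c) 1) * y) = k * φ y := by
    rw [← zsmul_eq_mul, map_zsmul, smul_eq_mul]
  have hφx : φ x = 0 := by
    rw [hφ, ← algebraMap_norm_eq_mul_star]; rfl
  have hφω : φ (ω * x) = x.norm := by
    rw [hφ, mul_assoc, ← algebraMap_norm_eq_mul_star]
    simp
  have hker (y : QuadraticAlgebra ℤ (-c) 1) (hy : y ∈ I) (h : φ y = 0) :
      ∃ q : ℤ, y = (q : QuadraticAlgebra ℤ (-c) 1) * x :=
    eq_intCast_mul_of_norm_minimal hc hx hx0 hmin hy h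
  obtain ⟨n, y₀, hn, hy₀, hnφ, hgen⟩ : ∃ (n : ℕ) (y₀ : QuadraticAlgebra ℤ (-c) 1),
      0 < n ∧ y₀ ∈ I ∧ n * φ y₀ = x.norm ∧ ∀ y ∈ I, φ y₀ ∣ φ y := by
    let L : Ideal ℤ := (I.restrictScalars ℤ).map φ
    obtain ⟨g, hg⟩ := (IsPrincipalIdealRing.principal L).principal
    have hmem (y : QuadraticAlgebra ℤ (-c) 1) (hy : y ∈ I) : g ∣ φ y := by
      have : φ y ∈ L := Submodule.mem_map_of_mem (by simpa using hy)
      rw [hg] at this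
      exact Ideal.mem_span_singleton.mp this
    have hgL : g ∈ L := by rw [hg]; exact Ideal.mem_span_singleton_self g
    obtain ⟨y, hy, hyg⟩ := Submodule.mem_map.mp hgL
    obtain ⟨k, hk⟩ := hmem _ (I.mul_mem_left ω hx)
    rw [hφω] at hk
    rcases lt_trichotomy k 0 with h | h | h
    · refine ⟨k.natAbs, -y, by omega, I.neg_mem hy, ?_, fun z hz => ?_⟩
      · rw [map_neg, hyg, hk, Int.natCast_natAbs, abs_of_neg h]; ring
      · rw [map_neg, hyg, neg_dvd]; exact hmem z hz
    · rw [h, mul_zero] at hk; omega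
    · refine ⟨k.natAbs, y, by omega, hy, ?_, fun z hz => ?_⟩
      · rw [hyg, hk, Int.natCast_natAbs, abs_of_pos h]; ring
      · rw [hyg]; exact hmem z hz
  obtain ⟨q₀, hq₀⟩ := hker (ω * x - (n : QuadraticAlgebra ℤ (-c) 1) * y₀)
    (I.sub_mem (I.mul_mem_left _ hx) (I.mul_mem_left _ hy₀)) (by
      rw [map_sub, hφω, ← hnφ, ← Int.cast_natCast (R := QuadraticAlgebra ℤ (-c) 1), hφz,
        sub_self])
  have hshift (m : ℤ) (hm : (n : ℤ) ∣ m + q₀) :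
      ∃ y ∈ I, n * φ y = x.norm ∧ (∀ z ∈ I, φ y ∣ φ z) ∧
        (ω + (m : QuadraticAlgebra ℤ (-c) 1)) * x = (n : QuadraticAlgebra ℤ (-c) 1) * y := by
    obtain ⟨j, hj⟩ := hm
    have hφ' : φ (y₀ + (j : QuadraticAlgebra ℤ (-c) 1) * x) = φ y₀ := by
      rw [map_add, hφz, hφx, mul_zero, add_zero]
    refine ⟨y₀ + j * x, I.add_mem hy₀ (I.mul_mem_left _ hx), by rw [hφ', hnφ],
      by rwa [hφ'], ?_⟩
    have hm : m = n * j - q₀ := by omega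
    rw [hm]
    push_cast
    linear_combination hq₀
  have hdiv (y : QuadraticAlgebra ℤ (-c) 1) (hgen : ∀ z ∈ I, φ y ∣ φ z) (hy : y ∈ I)
      (z : QuadraticAlgebra ℤ (-c) 1) (hz : z ∈ I) :
      ∃ t q : ℤ, z = (t : QuadraticAlgebra ℤ (-c) 1) * y + q * x := by
    obtain ⟨t, ht⟩ := hgen z hz
    obtain ⟨q, hq⟩ := hker (z - (t : QuadraticAlgebra ℤ (-c) 1) * y)
      (I.sub_mem hz (I.mul_mem_left _ hy))
      (by rw [map_sub, hφz, ht]; ring)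
    exact ⟨t, q, by linear_combination hq⟩
  have hnormω (m : ℤ) : norm (ω + (m : QuadraticAlgebra ℤ (-c) 1)) = m ^ 2 + m + c := by
    simp [norm_def]; ring
  have hn' : (0 : ℤ) < n := by exact_mod_cast hn
  have hbound : 3 * (n : ℤ) ^ 2 ≤ 4 * c - 1 := by
    obtain ⟨m, hm, hm1, hm2⟩ : ∃ m : ℤ, (n : ℤ) ∣ m + q₀ ∧ -n ≤ 2 * m + 1 ∧ 2 * m + 1 ≤ n := by
      set e := (2 * (-q₀) + 1 + n) / (2 * n) with he
      have h1 := Int.emod_nonneg (2 * (-q₀) + 1 + n) (show (2 * n : ℤ) ≠ 0 by omega)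
      have h2 := Int.emod_lt_of_pos (2 * (-q₀) + 1 + n) (show 0 < (2 * n : ℤ) by omega)
      rw [Int.emod_def, ← he] at h1 h2
      exact ⟨-q₀ - n * e, ⟨-e, by ring⟩, by linarith, by linarith⟩
    obtain ⟨y, hy, hyn, -, hyx⟩ := hshift m hm
    have hy0 : y ≠ 0 := by
      rintro rfl
      rw [map_zero, mul_zero] at hyn
      omega
    have h1 := congrArg norm hyx
    rw [map_mul, map_mul, hnormω, norm_natCast] at h1
    have h2 := hmin y hy hy0
    have h3 : (n : ℤ) ^ 2 ≤ m ^ 2 + m + c := by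
      refine le_of_mul_le_mul_right ?_ hN
      rw [h1]
      gcongr
    have h4 : (2 * m + 1) ^ 2 ≤ (n : ℤ) ^ 2 := sq_le_sq.mpr (by
      rw [abs_of_pos hn']; exact abs_le.mpr ⟨hm1, hm2⟩)
    linarith
  have hm0 := Int.emod_nonneg (-q₀) hn'.ne'
  obtain ⟨m, hm⟩ := Int.eq_ofNat_of_zero_le hm0
  have hmn : m < n := by
    have := Int.emod_lt_of_pos (-q₀) hn'
    omega
  obtain ⟨y, hy, hyn, hgen, hyx⟩ := hshift m (by
    rw [← hm, Int.emod_def]; exact ⟨-(-q₀ / n), by ring⟩)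
  refine ⟨n, m, x, hx0, hmn, hbound, ?_, ?_⟩
  · obtain ⟨t, q, htq⟩ := hdiv y hgen hy (star (ω + ((m : ℤ) : QuadraticAlgebra ℤ (-c) 1)) * y)
      (I.mul_mem_left _ hy)
    have h1 : (ω + ((m : ℤ) : QuadraticAlgebra ℤ (-c) 1)) *
        star (ω + ((m : ℤ) : QuadraticAlgebra ℤ (-c) 1)) =
        (((m : ℤ) ^ 2 + m + c : ℤ) : QuadraticAlgebra ℤ (-c) 1) := by
      rw [← algebraMap_norm_eq_mul_star, hnormω]; rfl
    have h2 : ((((m : ℤ) ^ 2 + m + c : ℤ) : QuadraticAlgebra ℤ (-c) 1) -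
        (t : QuadraticAlgebra ℤ (-c) 1) * (ω + ((m : ℤ) : QuadraticAlgebra ℤ (-c) 1)) -
        (q : QuadraticAlgebra ℤ (-c) 1) * (n : QuadraticAlgebra ℤ (-c) 1)) * x = 0 := by
      rw [← h1]
      linear_combination (star (ω + ((m : ℤ) : QuadraticAlgebra ℤ (-c) 1)) - t) * hyx + n * htq
    have h3 := eq_zero_of_mul_eq_zero_of_ne_zero hc hx0 h2
    generalize (m : ℤ) ^ 2 + m + c = d at h3 ⊢
    have him := congrArg QuadraticAlgebra.im h3
    have hre := congrArg QuadraticAlgebra.re h3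
    simp at him hre
    refine ⟨q, ?_⟩
    rw [him] at hre
    linarith
  · have hyx' : (ω + (m : QuadraticAlgebra ℤ (-c) 1)) * x =
        (n : QuadraticAlgebra ℤ (-c) 1) * y := by simpa using hyx
    apply le_antisymm
    · rw [Ideal.span_singleton_mul_le_span_singleton_mul]
      intro z hz
      obtain ⟨t, q, rfl⟩ := hdiv y hgen hy z hz
      refine ⟨(t : QuadraticAlgebra ℤ (-c) 1) * (ω + (m : QuadraticAlgebra ℤ (-c) 1)) +
        (q : QuadraticAlgebra ℤ (-c) 1) * (n : QuadraticAlgebra ℤ (-c) 1),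
        Ideal.add_mem _ (Ideal.mul_mem_left _ _ (Ideal.subset_span (by simp)))
          (Ideal.mul_mem_left _ _ (Ideal.subset_span (by simp))), ?_⟩
      linear_combination (-t : QuadraticAlgebra ℤ (-c) 1) * hyx'
    · rw [Ideal.span_mul_span', Ideal.span_le]
      rintro _ ⟨a, rfl, b, hb, rfl⟩
      simp only [Set.mem_insert_iff, Set.mem_singleton_iff] at hb
      rw [SetLike.mem_coe, Ideal.mem_span_singleton_mul]
      rcases hb with rfl | rfl
      · exact ⟨a, hx, mul_comm _ _⟩
      · exact ⟨y, hy, by rw [← hyx']; exact mul_comm _ _⟩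

end QuadraticAlgebra

open scoped nonZeroDivisors NumberField

namespace NumberField

/-- The ring of integers of `ℚ(√-p)` for a prime `p = 4 * c - 1` is `ℤ[(1 + √-p) / 2]`. -/
theorem nonempty_ringEquiv_ringOfIntegers_of_sq_eq_neg_prime {p : ℕ} (hp : p.Prime) {c : ℤ}
    (hc : 4 * c = p + 1) (K : Type*) [Field K] [NumberField K] {α : K}
    (hα : α ^ 2 = -(p : K)) (hK : Algebra.adjoin ℚ {α} = ⊤) :
    Nonempty (QuadraticAlgebra ℤ (-c) 1 ≃+* 𝓞 K) := by
  have hcK : 4 * (c : K) = p + 1 := by exact_mod_cast congrArg (Int.cast (R := K)) hc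
  have hp0 : (0 : ℚ) < p := by exact_mod_cast hp.pos
  set β : K := (1 + α) / 2 with hβ
  have hβ2 : β * β = β - c := by
    rw [hβ]; linear_combination hα / 4 + hcK / 4
  have hβint : IsIntegral ℤ β := by
    refine ⟨Polynomial.X ^ 2 - Polynomial.X + Polynomial.C c, by monicity!, ?_⟩
    simp only [sq, Polynomial.eval₂_add, Polynomial.eval₂_sub, Polynomial.eval₂_mul,
      Polynomial.eval₂_X, Polynomial.eval₂_C]
    rw [eq_intCast]
    linear_combination hβ2
  obtain ⟨b, hbβ⟩ : ∃ b : 𝓞 K, (b : K) = β := ⟨⟨β, hβint⟩, rfl⟩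
  have hb : b * b = (-c) • 1 + (1 : ℤ) • b := by
    apply RingOfIntegers.ext
    simp [hbβ, hβ2]; ring
  let f : QuadraticAlgebra ℤ (-c) 1 →ₐ[ℤ] 𝓞 K := QuadraticAlgebra.lift ⟨b, hb⟩
  have hf (z : QuadraticAlgebra ℤ (-c) 1) : (f z : K) = z.re + z.im * β := by
    simp [f, hbβ]
  let g : QuadraticAlgebra ℚ (-p) 0 →ₐ[ℚ] K := QuadraticAlgebra.lift ⟨α, by
    rw [← sq, hα]; simp [Algebra.smul_def]⟩
  have hg (z : QuadraticAlgebra ℚ (-p) 0) : g z = z.re + z.im * α := by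
    simp [g, Algebra.smul_def]
  have : Fact (∀ r : ℚ, r ^ 2 ≠ -p + 0 * r) := ⟨fun r h => by nlinarith [sq_nonneg r]⟩
  have hginj : Function.Injective g := g.toRingHom.injective
  have hgsurj : Function.Surjective g := by
    rw [← AlgHom.range_eq_top, ← top_le_iff, ← hK, Algebra.adjoin_le_iff,
      Set.singleton_subset_iff]
    exact ⟨⟨0, 1⟩, by simp [hg]⟩
  refine ⟨RingEquiv.ofBijective f ⟨?_, ?_⟩⟩
  · rw [injective_iff_map_eq_zero]
    intro z hz
    have h1 : g ⟨z.re + z.im / 2, z.im / 2⟩ = 0 := by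
      have h2 : (f z : K) = 0 := by rw [hz]; rfl
      rw [hf, hβ] at h2
      rw [hg]
      push_cast
      linear_combination h2
    rw [map_eq_zero_iff g hginj] at h1
    have him := congrArg QuadraticAlgebra.im h1
    have hre := congrArg QuadraticAlgebra.re h1
    simp at him hre
    rw [him] at hre
    exact QuadraticAlgebra.ext (by simpa using hre) him
  · intro x
    obtain ⟨z, hz⟩ := hgsurj x
    have hzint : IsIntegral ℤ z := by
      rw [← isIntegral_algHom_iff (g.restrictScalars ℤ) hginj]
      simpa [hz] using x.isIntegral_coe
    have hsint : IsIntegral ℤ (star z) :=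
      hzint.map (starRingEnd (QuadraticAlgebra ℚ (-p) 0)).toIntAlgHom
    have hint {w : QuadraticAlgebra ℚ (-p) 0} (hw : IsIntegral ℤ w) (him : w.im = 0) :
        ∃ k : ℤ, w.re = k := by
      have h := hw.map (g.restrictScalars ℤ)
      have hgw : g.restrictScalars ℤ w = algebraMap ℚ K w.re := by simp [hg, him]
      rw [hgw, isIntegral_algebraMap_iff (algebraMap ℚ K).injective] at h
      obtain ⟨k, hk⟩ := IsIntegrallyClosed.isIntegral_iff.mp h
      exact ⟨k, by simpa using hk.symm⟩
    obtain ⟨A, hA⟩ := hint (hzint.add hsint) (by simp)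
    obtain ⟨N, hN⟩ := hint (hzint.mul hsint) (by simp; ring)
    have hA : 2 * z.re = A := by
      rw [← hA]; simp; ring
    have hN : z.re ^ 2 + p * z.im ^ 2 = N := by
      rw [← hN]; simp; ring
    have hsq : (2 * p * z.im) ^ 2 = ((p * (4 * N - A ^ 2) : ℤ) : ℚ) := by
      push_cast
      rw [← hN, ← hA]
      ring
    obtain ⟨T, hT⟩ : ∃ T : ℤ, 2 * p * z.im = T := by
      have : IsIntegral ℤ (2 * p * z.im) := by
        refine IsIntegral.of_pow two_pos ?_
        rw [hsq]
        exact isIntegral_algebraMap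
      obtain ⟨k, hk⟩ := IsIntegrallyClosed.isIntegral_iff.mp this
      exact ⟨k, by simpa using hk.symm⟩
    rw [hT] at hsq
    have hsq' : T ^ 2 = p * (4 * N - A ^ 2) := by exact_mod_cast hsq
    have hpT : (p : ℤ) ∣ T :=
      (Nat.prime_iff_prime_int.mp hp).dvd_of_dvd_pow ⟨_, hsq'⟩
    obtain ⟨B, rfl⟩ := hpT
    have hpZ : (p : ℤ) ≠ 0 := by exact_mod_cast hp.ne_zero
    have hAB : p * B ^ 2 = 4 * N - A ^ 2 := mul_left_cancel₀ hpZ (by rw [← hsq']; ring)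
    have hB : 2 * z.im = B := by
      push_cast at hT
      exact mul_left_cancel₀ hp0.ne' (by linarith)
    obtain ⟨u, hu⟩ : ∃ u, A = B + 2 * u := by
      have h2 : (2 : ℤ) ∣ (A - B) * (A + B) :=
        ⟨2 * (N - c * B ^ 2), by linear_combination hAB + B ^ 2 * hc⟩
      rcases Int.prime_two.dvd_or_dvd h2 with ⟨k, hk⟩ | ⟨k, hk⟩
      · exact ⟨k, by linarith⟩
      · exact ⟨k - B, by linarith⟩
    refine ⟨⟨u, B⟩, RingOfIntegers.ext ?_⟩
    rw [hf, ← hz, hg]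
    have hre : z.re = u + B / 2 := by
      rw [hu] at hA; push_cast at hA; linarith
    have him : z.im = B / 2 := by linarith
    rw [hre, him, hβ]
    push_cast
    ring

end NumberField

/-- Every class contains the ideal `(n, ω + m)` of a binary quadratic form of
discriminant `1 - 4 * c` with small leading coefficient `n`. -/
theorem NumberField.exists_mk0_eq_of_ringEquiv {c : ℤ} (hc : 0 < c) {K : Type*} [Field K]
    [NumberField K] (e : QuadraticAlgebra ℤ (-c) 1 ≃+* 𝓞 K) (C : ClassGroup (𝓞 K)) :
    ∃ (n m : ℕ) (J : (Ideal (𝓞 K))⁰), m < n ∧ 3 * (n : ℤ) ^ 2 ≤ 4 * c - 1 ∧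
      (n : ℤ) ∣ (m : ℤ) ^ 2 + m + c ∧ (J : Ideal (𝓞 K)) = Ideal.span {(n : 𝓞 K), e ω + m} ∧
      ClassGroup.mk0 J = C := by
  obtain ⟨I, rfl⟩ := ClassGroup.mk0_surjective C
  have hI : (I : Ideal (𝓞 K)) ≠ ⊥ := nonZeroDivisors.ne_zero I.2
  obtain ⟨n, m, x, hx, hmn, hn, hdvd, heq⟩ :=
    QuadraticAlgebra.exists_span_mul_eq_span_mul_reduced hc (I := (I : Ideal (𝓞 K)).map e.symm) 
      (by rwa [Ne, Ideal.map_eq_bot_iff_of_injective e.symm.injective])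
  have hn0 : (n : 𝓞 K) ≠ 0 := by exact_mod_cast (by omega : n ≠ 0)
  have heq' := congrArg (Ideal.map e) heq
  rw [Ideal.map_mul, Ideal.map_mul, Ideal.map_symm, Ideal.map_comap_eq_self_of_equiv,
    Ideal.map_span, Ideal.map_span, Ideal.map_span, Set.image_pair, Set.image_singleton,
    Set.image_singleton, map_natCast, map_add, map_natCast] at heq'
  obtain ⟨J, hJ⟩ : ∃ J : (Ideal (𝓞 K))⁰, (J : Ideal (𝓞 K)) = Ideal.span {(n : 𝓞 K), e ω + m} := by
    have hne : Ideal.span {(n : 𝓞 K), e ω + m} ≠ ⊥ := fun h =>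
      hn0 (Ideal.span_eq_bot.mp h _ (Set.mem_insert _ _))
    exact ⟨⟨Ideal.span {(n : 𝓞 K), e ω + m}, mem_nonZeroDivisors_of_ne_zero hne⟩, rfl⟩
  refine ⟨n, m, J, hmn, hn, hdvd, hJ, Eq.symm ?_⟩
  rw [← hJ] at heq'
  exact ClassGroup.mk0_eq_mk0_iff.mpr
    ⟨(n : 𝓞 K), e x, hn0, (map_ne_zero_iff e e.injective).mpr hx, heq'⟩

/-- For a prime `p ≡ 3 (mod 8)`, `p > 3`, the class number of the imaginary
quadratic field `ℚ(√-p)` is at most `(p-1)/6`. -/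
theorem classNumber_le_of_three_mod_eight
    (p : ℕ) (hp : p.Prime) (hmod : p % 8 = 3) (hgt : 3 < p)
    (K : Type) [Field K] [NumberField K] (α : K)
    (hα : α ^ 2 = -(p : K)) (hK : Algebra.adjoin ℚ {α} = ⊤) :
    (NumberField.classNumber K : ℚ) ≤ ((p : ℚ) - 1) / 6 := by
  obtain ⟨k, hk⟩ : ∃ k : ℕ, p = 8 * k + 3 := ⟨p / 8, by omega⟩
  have hc : (0 : ℤ) < 2 * k + 1 := by omega
  obtain ⟨e⟩ := NumberField.nonempty_ringEquiv_ringOfIntegers_of_sq_eq_neg_prime hp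
    (c := 2 * k + 1) (by omega) K hα hK
  choose n m J hmn hn hdvd hJ hC using NumberField.exists_mk0_eq_of_ringEquiv hc e
  have hodd (C : ClassGroup (𝓞 K)) : n C % 2 = 1 := by
    by_contra h
    have h2 : (2 : ℤ) ∣ (m C : ℤ) ^ 2 + m C + (2 * k + 1) := by
      exact dvd_trans (by omega) (hdvd C)
    have h3 : (2 : ℤ) ∣ (m C : ℤ) * (m C + 1) := (Int.even_mul_succ_self _).two_dvd
    rw [sq] at h2
    rw [mul_add] at h3
    omega
  obtain ⟨s, hs, hs'⟩ : ∃ s : ℕ,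
      (∀ j : ℕ, 3 * (2 * j + 1) ^ 2 ≤ p → j < s) ∧ 6 * s ^ 2 + 1 ≤ p := by
    let j := Nat.findGreatest (fun j => 3 * (2 * j + 1) ^ 2 ≤ p) p
    have hj : 3 * (2 * j + 1) ^ 2 ≤ p :=
      Nat.findGreatest_spec (P := fun j => 3 * (2 * j + 1) ^ 2 ≤ p) (Nat.zero_le p) (by omega)
    refine ⟨j + 1, fun i hi => Nat.lt_succ_of_le (Nat.le_findGreatest (by nlinarith) hi), ?_⟩
    rcases Nat.eq_zero_or_pos j with h | h
    · rw [h]; omega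
    · nlinarith
  let S : Finset (Σ _ : ℕ, ℕ) := (Finset.range s).sigma fun j => Finset.range (2 * j + 1)
  have hcard : S.card = s ^ 2 := by
    rw [Finset.card_sigma]
    simp only [Finset.card_range]
    clear S hs hs'
    induction s with
    | zero => rfl
    | succ s ih => rw [Finset.sum_range_succ, ih]; ring
  have hle : NumberField.classNumber K ≤ s ^ 2 := by
    rw [NumberField.classNumber, ← hcard, ← Finset.card_univ]
    refine Finset.card_le_card_of_injOn (fun C => ⟨n C / 2, m C⟩) (fun C _ => ?_) ?_
    · have h1 := hodd C
      have h2 := hmn C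
      have h3 : 2 * (n C / 2) + 1 = n C := by omega
      have h4 := hs (n C / 2) (by rw [h3]; zify; have := hn C; push_cast [hk]; linarith)
      simp only [S, Finset.coe_sigma, Set.mem_sigma_iff, Finset.mem_coe, Finset.mem_range]
      omega
    · intro C _ D _ h
      simp only [Sigma.mk.injEq, heq_eq_eq] at h
      have h1 := hodd C
      have h2 := hodd D
      have h3 : n C = n D := by omega
      rw [← hC C, ← hC D]
      congr 1
      exact Subtype.ext (by rw [hJ, hJ, h3, h.2])
  have h1 : (NumberField.classNumber K : ℚ) ≤ (s : ℚ) ^ 2 := by exact_mod_cast hle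
  have h2 : 6 * (s : ℚ) ^ 2 + 1 ≤ p := by exact_mod_cast hs'
  linarith
end

section
/- Let p be a prime with p ≡ 3 (mod 8) and p > 11. Then (p−1)(p−7)/24 > 1 + 2·h, where h is the class number of the imaginary quadratic field ℚ(√−p). -/
open scoped nonZeroDivisors

section IdealClasses

variable {R : Type*} [CommRing R]

theorem Ideal.span_singleton_mul_span_pair (x y z : R) :
    Ideal.span {x} * Ideal.span {y, z} = Ideal.span {x * y, x * z} := by
  rw [Ideal.span_mul_span', Set.singleton_mul, Set.image_pair]

/-- The second coordinates of the elements of an ideal of `ℤ[ω]`. -/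
def secondCoordIdeal (ω : R) (I : Ideal R) : Ideal ℤ where
  carrier := {x | ∃ y : ℤ, (y : R) + x * ω ∈ I}
  zero_mem' := ⟨0, by simp⟩
  add_mem' := by
    rintro x x' ⟨y, hy⟩ ⟨y', hy'⟩
    refine ⟨y + y', ?_⟩
    convert I.add_mem hy hy' using 1
    push_cast
    ring
  smul_mem' := by
    rintro t x ⟨y, hy⟩
    refine ⟨t * y, ?_⟩
    convert I.mul_mem_left (t : R) hy using 1
    push_cast [smul_eq_mul]
    ring

theorem mem_secondCoordIdeal {ω : R} {I : Ideal R} {x : ℤ} :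
    x ∈ secondCoordIdeal ω I ↔ ∃ y : ℤ, (y : R) + x * ω ∈ I := Iff.rfl

theorem exists_int_mem_of_ne_bot {ω : R} {k : ℤ} (hk : 1 ≤ k) (hω : ω ^ 2 = ω - k)
    (hspan : ∀ z : R, ∃ x y : ℤ, z = y + x * ω) {I : Ideal R} (hI : I ≠ ⊥) :
    ∃ n : ℤ, n ≠ 0 ∧ (n : R) ∈ I := by
  obtain ⟨z, hz, hz0⟩ := Submodule.exists_mem_ne_zero_of_ne_bot hI
  obtain ⟨x, y, rfl⟩ := hspan z
  refine ⟨y ^ 2 + x * y + k * x ^ 2, ?_, ?_⟩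
  · intro h
    have hx : x = 0 := by
      by_contra hx
      have : 0 < x ^ 2 := by positivity
      nlinarith [sq_nonneg (2 * y + x)]
    have hy : y = 0 := by
      subst hx
      simpa using h
    simp [hx, hy] at hz0
  · convert I.mul_mem_left ((y : R) + x - x * ω) hz using 1
    push_cast
    linear_combination (x : R) ^ 2 * hω

variable [IsDedekindDomain R]

/-- The class `C` is represented by the ideal `(m, c + ω)`, where `m` divides the norm
`c ^ 2 + c + k` of `c + ω`. -/
def IsPrimitiveRep (ω : R) (k : ℤ) (C : ClassGroup R) (m : ℕ) (c : ℤ) : Prop :=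
  0 < m ∧ (m : ℤ) ∣ c ^ 2 + c + k ∧
    ∃ J : (Ideal R)⁰, (J : Ideal R) = Ideal.span {(m : R), (c : R) + ω} ∧ ClassGroup.mk0 J = C

theorem IsPrimitiveRep.add_mul {ω : R} {k : ℤ} {C : ClassGroup R} {m : ℕ} {c : ℤ}
    (h : IsPrimitiveRep ω k C m c) (t : ℤ) : IsPrimitiveRep ω k C m (c + m * t) := by
  obtain ⟨hm, hdvd, J, hJ, hC⟩ := h
  refine ⟨hm, ?_, J, ?_, hC⟩
  · have := dvd_add hdvd (dvd_mul_right (m : ℤ) (t * (2 * c + m * t + 1)))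
    ring_nf at this ⊢
    exact this
  · rw [hJ, ← Ideal.span_pair_add_left_mul (z := (t : R))]
    congr 2
    push_cast
    ring_nf

variable [CharZero R]

theorem exists_isPrimitiveRep {ω : R} {k : ℤ} (hk : 1 ≤ k) (hω : ω ^ 2 = ω - k)
    (hspan : ∀ z : R, ∃ x y : ℤ, z = y + x * ω) (C : ClassGroup R) :
    ∃ m c, IsPrimitiveRep ω k C m c := by
  obtain ⟨⟨I, hI⟩, rfl⟩ := ClassGroup.mk0_surjective C
  obtain ⟨n₀, hn₀, hn₀I⟩ := exists_int_mem_of_ne_bot hk hω hspan (nonZeroDivisors.ne_zero hI)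
  obtain ⟨n, hn⟩ := (IsPrincipalIdealRing.principal (I.comap (Int.castRingHom R))).principal
  obtain ⟨d, hd⟩ := (IsPrincipalIdealRing.principal (secondCoordIdeal ω I)).principal
  have hn' (a : ℤ) : (a : R) ∈ I ↔ n ∣ a := by
    rw [← Ideal.mem_span_singleton, Ideal.span, ← hn]
    simp
  have hd' (x : ℤ) : (∃ y : ℤ, (y : R) + x * ω ∈ I) ↔ d ∣ x := by
    rw [← mem_secondCoordIdeal, ← Ideal.mem_span_singleton, Ideal.span, ← hd]
  have hn0 : n ≠ 0 := by
    rintro rfl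
    exact hn₀ (zero_dvd_iff.mp ((hn' _).mp hn₀I))
  have hnI : (n : R) ∈ I := (hn' n).mpr dvd_rfl
  obtain ⟨m, rfl⟩ : d ∣ n := by
    refine (hd' n).mp ⟨0, ?_⟩
    convert I.mul_mem_left ω hnI using 1
    push_cast
    ring
  obtain ⟨c', hc'⟩ := (hd' d).mpr dvd_rfl
  obtain ⟨c, rfl⟩ : d ∣ c' := by
    have : d ∣ c' + d := by
      refine (hd' _).mp ⟨-d * k, ?_⟩
      convert I.mul_mem_left ω hc' using 1
      push_cast
      linear_combination -(d : R) * hω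
    exact (dvd_add_left dvd_rfl).mp this
  have hd0 : d ≠ 0 := left_ne_zero_of_mul hn0
  have hm0 : m ≠ 0 := right_ne_zero_of_mul hn0
  have habs : Ideal.span {((m.natAbs : ℕ) : R), (c : R) + ω} = Ideal.span {(m : R), (c : R) + ω} := by
    rw [Ideal.span_insert, Ideal.span_insert]
    congr 1
    rw [Ideal.span_singleton_eq_span_singleton]
    rcases Int.natAbs_eq m with h | h
    · conv_rhs => rw [h]
      simp
    · conv_rhs => rw [h]
      simp
  have hspanI : I = Ideal.span {(d : R)} * Ideal.span {(m : R), (c : R) + ω} := by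
    rw [Ideal.span_singleton_mul_span_pair]
    apply le_antisymm
    · intro z hz
      obtain ⟨x, y, rfl⟩ := hspan z
      obtain ⟨t, rfl⟩ := (hd' x).mp ⟨y, hz⟩
      obtain ⟨u, hu⟩ : d * m ∣ y - t * (d * c) := by
        refine (hn' _).mp ?_
        convert I.sub_mem hz (I.mul_mem_left (t : R) hc') using 1
        push_cast
        ring
      have hu' : (y : R) - t * (d * c) = d * m * u := by
        exact_mod_cast congrArg (Int.cast (R := R)) hu
      refine Ideal.mem_span_pair.mpr ⟨u, t, ?_⟩
      push_cast
      linear_combination -hu'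
    · rw [Ideal.span_le, Set.insert_subset_iff, Set.singleton_subset_iff]
      exact ⟨by exact_mod_cast hnI, by simpa [mul_add] using hc'⟩
  have hJ : Ideal.span {((m.natAbs : ℕ) : R), (c : R) + ω} ∈ (Ideal R)⁰ := by
    rw [mem_nonZeroDivisors_iff_ne_zero, habs]
    rintro h
    rw [h, mul_zero] at hspanI
    exact nonZeroDivisors.ne_zero hI hspanI
  refine ⟨m.natAbs, c, Int.natAbs_pos.mpr hm0, ?_, ⟨_, hJ⟩, rfl, ?_⟩
  · rw [Int.natCast_natAbs, abs_dvd]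
    refine Int.dvd_of_mul_dvd_mul_left hd0 ((hn' _).mp ?_)
    convert I.mul_mem_left ((c : R) + 1 - ω) hc' using 1
    push_cast
    linear_combination (d : R) * hω
  · rw [ClassGroup.mk0_eq_mk0_iff]
    refine ⟨d, 1, by exact_mod_cast hd0, one_ne_zero, ?_⟩
    simp only [habs, ← hspanI]
    simp

theorem IsPrimitiveRep.conj {ω : R} {k : ℤ} (hω : ω ^ 2 = ω - k) {C : ClassGroup R}
    {m m' : ℕ} {c : ℤ} (h : IsPrimitiveRep ω k C m c) (hm' : 0 < m')
    (hmm : c ^ 2 + c + k = m * m') : IsPrimitiveRep ω k C m' (-c - 1) := by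
  obtain ⟨hm, hdvd, J, hJ, hC⟩ := h
  have hmR : (m : R) ≠ 0 := by exact_mod_cast hm.ne'
  have hmR' : (m' : R) ≠ 0 := by exact_mod_cast hm'.ne'
  have hmm' : (c : R) ^ 2 + c + k = m * m' := by exact_mod_cast congrArg (Int.cast (R := R)) hmm
  have hprod : ((c : R) + ω) * (c + 1 - ω) = m * m' := by
    linear_combination hmm' - hω
  refine ⟨hm', ⟨m, by linear_combination hmm⟩, ⟨_, ?_⟩, rfl, ?_⟩
  · rw [mem_nonZeroDivisors_iff_ne_zero]
    intro h0
    have : (m' : R) ∈ (0 : Ideal R) := h0 ▸ Ideal.subset_span (by simp)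
    exact hmR' (by simpa using this)
  · rw [← hC, ClassGroup.mk0_eq_mk0_iff]
    refine ⟨m, c + 1 - ω, hmR, ?_, ?_⟩
    · intro h0
      rw [h0, mul_zero] at hprod
      exact mul_ne_zero hmR hmR' hprod.symm
    · have hneg : ((-c - 1 : ℤ) : R) + ω = -(c + 1 - ω) := by
        push_cast
        ring
      change Ideal.span {(m : R)} * Ideal.span {(m' : R), ((-c - 1 : ℤ) : R) + ω} =
        Ideal.span {(c : R) + 1 - ω} * J
      rw [hJ, hneg, Ideal.span_pair_neg, Ideal.span_singleton_mul_span_pair,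
        Ideal.span_singleton_mul_span_pair, mul_comm _ ((c : R) + ω), hprod, Ideal.span_pair_comm,
        mul_comm (m : R) (_ - _)]

/-- Every class contains a reduced ideal. -/
theorem exists_reduced_isPrimitiveRep {ω : R} {k : ℤ} (hk : 1 ≤ k) (hω : ω ^ 2 = ω - k)
    (hspan : ∀ z : R, ∃ x y : ℤ, z = y + x * ω) (C : ClassGroup R) :
    ∃ m c : ℕ, c < m ∧ 3 * (m : ℤ) ^ 2 ≤ 4 * k - 1 ∧ IsPrimitiveRep ω k C m c := by
  classical
  have hex := exists_isPrimitiveRep hk hω hspan C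
  obtain ⟨c₀, hc₀⟩ := Nat.find_spec hex
  set m := Nat.find hex
  have hm : (0 : ℤ) < m := by exact_mod_cast hc₀.1
  obtain ⟨c, hc, hc1, hc2⟩ : ∃ c, IsPrimitiveRep ω k C m c ∧ -(m : ℤ) ≤ 2 * c + 1 ∧
      2 * c + 1 ≤ m := by
    refine ⟨_, hc₀.add_mul (-((2 * c₀ + 1 + m) / (2 * m))), ?_⟩
    have h1 := Int.emod_add_mul_ediv (2 * c₀ + 1 + m) (2 * m)
    have h2 := Int.emod_nonneg (2 * c₀ + 1 + m) (b := 2 * m) (by positivity)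
    have h3 := Int.emod_lt_of_pos (2 * c₀ + 1 + m) (b := 2 * m) (by positivity)
    constructor <;> linarith
  refine ⟨m, (c % m).toNat, ?_, ?_, ?_⟩
  · have := Int.emod_lt_of_pos c hm
    have := Int.emod_nonneg c hm.ne'
    omega
  · obtain ⟨q, hq⟩ := hc.2.1
    have hpos : 0 < c ^ 2 + c + k := by nlinarith [sq_nonneg (2 * c + 1)]
    have hq0 : 0 < q := by
      rw [hq] at hpos
      exact pos_of_mul_pos_right hpos hm.le
    lift q to ℕ using hq0.le
    have hmin : m ≤ q := Nat.find_min' hex ⟨_, hc.conj hω (by exact_mod_cast hq0) hq⟩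
    have hmin' : (m : ℤ) ≤ q := by exact_mod_cast hmin
    nlinarith
  · rw [Int.toNat_of_nonneg (Int.emod_nonneg c hm.ne')]
    convert hc.add_mul (-(c / m)) using 1
    linarith [Int.emod_add_mul_ediv c m]

theorem card_classGroup_le {ω : R} {k : ℤ} (hk : 1 ≤ k) (hω : ω ^ 2 = ω - k)
    (hspan : ∀ z : R, ∃ x y : ℤ, z = y + x * ω) [Fintype (ClassGroup R)] :
    ∃ M : ℕ, 3 * (M : ℤ) ^ 2 ≤ 4 * k - 1 ∧ 2 * Fintype.card (ClassGroup R) ≤ M * (M + 1) := by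
  classical
  choose m c hcm hm hrep using exists_reduced_isPrimitiveRep hk hω hspan
  obtain ⟨C₀, -, hC₀⟩ := Finset.exists_max_image Finset.univ m ⟨1, Finset.mem_univ _⟩
  refine ⟨m C₀, hm C₀, ?_⟩
  have hcard : Fintype.card (ClassGroup R) ≤
      ((Finset.range (m C₀ + 1)).sigma fun i => Finset.range i).card := by
    rw [← Finset.card_univ]
    refine Finset.card_le_card_of_injOn (fun C => ⟨m C, c C⟩) ?_ ?_
    · intro C _
      have := hC₀ C (Finset.mem_univ _)
      simp [Nat.lt_succ_of_le this, hcm C]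
    · intro C _ C' _ h
      simp only [Sigma.mk.injEq, heq_eq_eq] at h
      obtain ⟨-, -, J, hJ, hC⟩ := hrep C
      obtain ⟨-, -, J', hJ', hC'⟩ := hrep C'
      rw [← hC, ← hC']
      congr 1
      apply Subtype.ext
      rw [hJ, hJ', h.1, h.2]
  rw [Finset.card_sigma] at hcard
  simp only [Finset.card_range] at hcard
  have := Finset.sum_range_id_mul_two (m C₀ + 1)
  simp only [Nat.add_sub_cancel] at this
  linarith

end IdealClasses

section QuadraticField

variable {K : Type*} [Field K] [NumberField K]

theorem exists_rat_coords {p : ℕ} {α : K} (hα : α ^ 2 = -(p : K))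
    (hK : Algebra.adjoin ℚ {α} = ⊤) (z : K) : ∃ a b : ℚ, z = a + b * α := by
  have hz : z ∈ Algebra.adjoin ℚ {α} := hK ▸ Algebra.mem_top
  induction hz using Algebra.adjoin_induction with
  | mem x hx => exact ⟨0, 1, by simpa using hx⟩
  | algebraMap r => exact ⟨r, 0, by simp⟩
  | add x y _ _ hx hy =>
    obtain ⟨a, b, rfl⟩ := hx
    obtain ⟨a', b', rfl⟩ := hy
    exact ⟨a + a', b + b', by push_cast; ring⟩
  | mul x y _ _ hx hy =>
    obtain ⟨a, b, rfl⟩ := hx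
    obtain ⟨a', b', rfl⟩ := hy
    refine ⟨a * a' - p * b * b', a * b' + a' * b, ?_⟩
    push_cast
    linear_combination (b : K) * b' * hα

theorem exists_int_eq_of_sq_eq {q : ℚ} {n : ℤ} (h : q ^ 2 = n) : ∃ v : ℤ, q = v := by
  have hq : IsIntegral ℤ q := by
    refine IsIntegral.of_pow two_pos ?_
    rw [h]
    exact isIntegral_algebraMap (x := n)
  obtain ⟨v, hv⟩ := IsIntegrallyClosed.isIntegral_iff.mp hq
  exact ⟨v, by simpa using hv.symm⟩

theorem exists_int_trace_norm {p : ℕ} (hp : 0 < p) {α : K} (hα : α ^ 2 = -(p : K)) {a b : ℚ}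
    (hz : IsIntegral ℤ ((a : K) + b * α)) :
    ∃ s n : ℤ, 2 * a = s ∧ a ^ 2 + p * b ^ 2 = n := by
  by_cases hb : b = 0
  · subst hb
    have ha : IsIntegral ℤ a := by
      rw [← isIntegral_algebraMap_iff (algebraMap ℚ K).injective]
      simpa using hz
    obtain ⟨v, hv⟩ := IsIntegrallyClosed.isIntegral_iff.mp ha
    refine ⟨2 * v, v ^ 2, ?_, ?_⟩ <;> simp [← hv]
  · open Polynomial in
    have hdeg : (X ^ 2 + (C (-(2 * a)) * X + C (a ^ 2 + p * b ^ 2)) : ℚ[X]).natDegree = 2 := by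
      compute_degree!
    have hmonic : (Polynomial.X ^ 2 + (Polynomial.C (-(2 * a)) * Polynomial.X +
        Polynomial.C (a ^ 2 + p * b ^ 2))).Monic := by
      monicity!
    have hirr : Irreducible (Polynomial.X ^ 2 + (Polynomial.C (-(2 * a)) * Polynomial.X +
        Polynomial.C (a ^ 2 + p * b ^ 2))) := by
      rw [Polynomial.irreducible_iff_roots_eq_zero_of_degree_le_three (by rw [hdeg])
        (by rw [hdeg]; norm_num), Multiset.eq_zero_iff_forall_notMem]
      intro r hr
      have hr' := Polynomial.isRoot_of_mem_roots hr
      simp only [Polynomial.IsRoot.def, Polynomial.eval_add, Polynomial.eval_pow,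
        Polynomial.eval_mul, Polynomial.eval_X, Polynomial.eval_C] at hr'
      have : 0 < (p : ℚ) * b ^ 2 := by positivity
      nlinarith [sq_nonneg (r - a)]
    have hmin := minpoly.eq_of_irreducible_of_monic hirr (x := (a : K) + b * α) (by
      simp only [map_add, map_mul, map_pow, Polynomial.aeval_X, Polynomial.aeval_C, eq_ratCast]
      push_cast
      linear_combination (b : K) ^ 2 * hα) hmonic
    rw [minpoly.isIntegrallyClosed_eq_field_fractions' ℚ hz] at hmin
    have h0 := congrArg (Polynomial.coeff · 0) hmin
    have h1 := congrArg (Polynomial.coeff · 1) hmin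
    simp only [Polynomial.coeff_add, Polynomial.coeff_X_pow, Polynomial.coeff_C_mul,
      Polynomial.coeff_X_zero, Polynomial.coeff_X_one, Polynomial.coeff_C_zero,
      Polynomial.coeff_C_succ, Polynomial.coeff_map, eq_intCast] at h0 h1
    norm_num at h0 h1
    exact ⟨-(minpoly ℤ ((a : K) + b * α)).coeff 1, _, by push_cast; linarith, h0⟩

theorem exists_int_coords {p : ℕ} (hp : p.Prime) (hmod : p % 4 = 3) {α : K}
    (hα : α ^ 2 = -(p : K)) (hK : Algebra.adjoin ℚ {α} = ⊤) {z : K} (hz : IsIntegral ℤ z) :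
    ∃ x y : ℤ, z = y + x * ((1 + α) / 2) := by
  obtain ⟨a, b, rfl⟩ := exists_rat_coords hα hK z
  obtain ⟨s, n, hs, hn⟩ := exists_int_trace_norm hp.pos hα hz
  obtain ⟨v, hv⟩ : ∃ v : ℤ, p * (2 * b) = v := by
    refine exists_int_eq_of_sq_eq (n := p * (4 * n - s ^ 2)) ?_
    push_cast
    rw [← hs, ← hn]
    ring
  have hv2 : v ^ 2 = p * (4 * n - s ^ 2) := by
    have : (v : ℚ) ^ 2 = p * (4 * n - s ^ 2) := by
      rw [← hv, ← hs, ← hn]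
      ring
    exact_mod_cast this
  obtain ⟨w, rfl⟩ : (p : ℤ) ∣ v :=
    (Nat.prime_iff_prime_int.mp hp).dvd_of_dvd_pow ⟨_, hv2⟩
  have hp0 : (p : ℤ) ≠ 0 := by exact_mod_cast hp.ne_zero
  have hw : (p : ℤ) * w ^ 2 = 4 * n - s ^ 2 := by
    apply mul_left_cancel₀ hp0
    linear_combination hv2
  have hb : 2 * b = w := by
    push_cast at hv
    exact mul_left_cancel₀ (by exact_mod_cast hp0) hv
  obtain ⟨y, hy⟩ : (2 : ℤ) ∣ s - w := by
    have h2 : (2 : ℤ) ∣ (s - w) ^ 2 := by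
      obtain ⟨j, hj⟩ : ∃ j : ℤ, (p : ℤ) = 4 * j + 3 := ⟨p / 4, by omega⟩
      rw [hj] at hw
      exact ⟨2 * n - 2 * j * w ^ 2 - w ^ 2 - s * w, by linear_combination hw⟩
    exact Int.prime_two.dvd_of_dvd_pow h2
  refine ⟨w, y, ?_⟩
  have hs' : 2 * (a : K) = s := by exact_mod_cast congrArg (Rat.cast (K := K)) hs
  have hb' : 2 * (b : K) = w := by exact_mod_cast congrArg (Rat.cast (K := K)) hb
  have hy' : (s : K) - w = 2 * y := by exact_mod_cast congrArg (Int.cast (R := K)) hy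
  linear_combination hs' / 2 + α * hb' / 2 + hy' / 2

end QuadraticField

/-- For a prime `p ≡ 3 (mod 8)`, `p > 11`, one has
`(p-1)(p-7)/24 > 1 + 2h`, where `h` is the class number of `ℚ(√-p)`. -/
theorem genus_gt_one_add_two_mul_classNumber
    (p : ℕ) (hp : p.Prime) (hmod : p % 8 = 3) (hgt : 11 < p)
    (K : Type) [Field K] [NumberField K] (α : K)
    (hα : α ^ 2 = -(p : K)) (hK : Algebra.adjoin ℚ {α} = ⊤) :
    ((p : ℚ) - 1) * ((p : ℚ) - 7) / 24 > 1 + 2 * (NumberField.classNumber K : ℚ) := by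
  obtain ⟨k, hk⟩ : ∃ k : ℤ, (p : ℤ) = 4 * k - 1 := ⟨(p + 1) / 4, by omega⟩
  have hkK : (p : K) = 4 * k - 1 := by exact_mod_cast congrArg (Int.cast (R := K)) hk
  have hsq : ((1 + α) / 2) ^ 2 = (1 + α) / 2 - (k : K) := by
    linear_combination hα / 4 - hkK / 4
  have hω_int : IsIntegral ℤ ((1 + α) / 2) := by
    refine ⟨Polynomial.X ^ 2 + (Polynomial.C (-1) * Polynomial.X + Polynomial.C k),
      by monicity!, ?_⟩
    rw [Polynomial.eval₂_add, Polynomial.eval₂_add, Polynomial.eval₂_mul, Polynomial.eval₂_pow,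
      Polynomial.eval₂_X, Polynomial.eval₂_C, Polynomial.eval₂_C, eq_intCast, eq_intCast]
    push_cast
    linear_combination hsq
  obtain ⟨ω, hω⟩ : ∃ ω : NumberField.RingOfIntegers K,
      algebraMap (NumberField.RingOfIntegers K) K ω = (1 + α) / 2 := ⟨⟨_, hω_int⟩, rfl⟩
  obtain ⟨M, hM, hcard⟩ := card_classGroup_le (R := NumberField.RingOfIntegers K)
    (ω := ω) (k := k) (by omega)
    (NumberField.RingOfIntegers.ext (by simpa [hω] using hsq))
    (fun z => by
      obtain ⟨x, y, h⟩ := exists_int_coords hp (by omega) hα hK z.isIntegral_coe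
      exact ⟨x, y, NumberField.RingOfIntegers.ext (by simpa [hω] using h)⟩)
  rw [← hk] at hM
  have hM' : 3 * M ^ 2 ≤ p := by exact_mod_cast hM
  have hh : 2 * NumberField.classNumber K ≤ M * (M + 1) := hcard
  have key : 24 * (2 * NumberField.classNumber K) + 8 * p + 17 < p ^ 2 := by
    rcases (show p = 19 ∨ 27 ≤ p by omega) with rfl | h27
    · have : M ≤ 2 := by nlinarith
      interval_cases M <;> omega
    · nlinarith [Nat.le_self_pow two_ne_zero M]
  have key' : 24 * (2 * (NumberField.classNumber K : ℚ)) + 8 * p + 17 < p ^ 2 := by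
    exact_mod_cast key
  linarith
end

section
/- Let α be a type, let u : α → α satisfy u ∘ u = id, and let s : ℕ → Finset α be a chain of finite subsets with s(i) ⊆ s(i+1) for all i and with each s(i) invariant under u (i.e., a ∈ s(i) implies u(a) ∈ s(i)). Fix n ≥ 1, and let F be the number of elements a ∈ s(n) with u(a) = a. Then the number of indices i with 0 ≤ i < n for which the cardinalities of s(i) and s(i+1) have different parities is at most F; moreover, if the cardinality of s(0) is odd, then this number of parity changes is at most F − 1. -/
/-- An involution of a finite set fixes as many points, modulo two, as the set has elements. -/
theorem card_filter_fixed_mod_two {α : Type*} [DecidableEq α] {u : α → α}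
    (hu : Function.Involutive u) (t : Finset α) (ht : ∀ a ∈ t, u a ∈ t) :
    (t.filter fun a => u a = a).card % 2 = t.card % 2 := by
  have hmoved : ((t.filter fun a => ¬ u a = a).card : ZMod 2) = 0 := by
    rw [Finset.card_eq_sum_ones, Nat.cast_sum]
    refine Finset.sum_involution (fun a _ => u a) ?_ ?_ ?_ ?_
    · intros
      decide
    · intro a ha _
      exact (Finset.mem_filter.mp ha).2
    · intro a ha
      rw [Finset.mem_filter] at ha ⊢
      exact ⟨ht a ha.1, fun h => ha.2 (hu.injective h)⟩
    · intro a _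
      exact hu a
  have hdvd := (ZMod.natCast_eq_zero_iff _ 2).mp hmoved
  have hsplit := Finset.card_filter_add_card_filter_not (s := t) (fun a => u a = a)
  omega

/-- The number of parity changes of a monotone sequence is at most its total increase. -/
theorem card_parity_changes_add_le {f : ℕ → ℕ} (hf : Monotone f) (n : ℕ) :
    ((Finset.range n).filter fun i => f i % 2 ≠ f (i + 1) % 2).card + f 0 ≤ f n := by
  induction n with
  | zero => simp
  | succ n ih =>
    have hstep := hf (Nat.le_succ n)
    rw [Finset.range_add_one, Finset.filter_insert]
    split_ifs with h
    · rw [Finset.card_insert_of_notMem (by simp)]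
      have hne : f n ≠ f (n + 1) := fun he => h (by rw [he])
      simp only [Nat.succ_eq_add_one] at hstep
      omega
    · exact ih.trans hstep


/-- If `u` is an involution of `α` and `s : ℕ → Finset α` is an increasing
chain of `u`-invariant finite sets, then for `n ≥ 1` the number of indices `i < n` at which
the parity of `|s i|` changes is at most the number `F` of fixed points of `u` in `s n`;
and at most `F - 1` if `|s 0|` is odd. -/
theorem parity_changes_le_fixed_points
    {α : Type*} [DecidableEq α] (u : α → α) (hu : u ∘ u = id)
    (s : ℕ → Finset α) (hmono : ∀ i, s i ⊆ s (i + 1))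
    (hinv : ∀ i, ∀ a ∈ s i, u a ∈ s i)
    (n : ℕ) (hn : 1 ≤ n)
    (F : ℕ) (hF : F = ((s n).filter fun a => u a = a).card) :
    ((Finset.range n).filter fun i => (s i).card % 2 ≠ (s (i + 1)).card % 2).card ≤ F ∧
      (Odd (s 0).card →
        ((Finset.range n).filter fun i => (s i).card % 2 ≠ (s (i + 1)).card % 2).card ≤ F - 1) := by
  have hfix : ∀ i, ((s i).filter fun a => u a = a).card % 2 = (s i).card % 2 := fun i =>
    card_filter_fixed_mod_two (u := u) (congrFun hu) (s i) (hinv i)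
  have hcount := card_parity_changes_add_le
    (f := fun i => ((s i).filter fun a => u a = a).card)
    (monotone_nat_of_le_succ fun i =>
      Finset.card_le_card (Finset.filter_subset_filter _ (hmono i))) n
  simp only [hfix, ← hF] at hcount
  refine ⟨by omega, fun hodd => ?_⟩
  have hzero := hfix 0
  rw [Nat.odd_iff] at hodd
  omega
end

section
/- Let α be a type and let f : ℕ → Finset α be a family of finite subsets such that f(gcd(a,b)) = f(a) ∩ f(b) for all integers a, b ≥ 1. Then for every n ≥ 1, f(n+1) ∩ (⋃_{i=1}^{n} f(i)) = ⋃_{q prime, q ∣ n+1} f((n+1)/q). -/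
theorem subset_of_dvd_of_map_gcd {α : Type*} [DecidableEq α] {f : ℕ → Finset α}
    (hf : ∀ a b : ℕ, 1 ≤ a → 1 ≤ b → f (Nat.gcd a b) = f a ∩ f b)
    {d m : ℕ} (hm : 1 ≤ m) (hd : d ∣ m) : f d ⊆ f m := by
  have h := hf d m (Nat.pos_of_dvd_of_pos hd hm) hm
  rw [Nat.gcd_eq_left hd] at h
  exact Finset.inter_eq_left.mp h.symm

theorem exists_prime_dvd_and_dvd_div {d m : ℕ} (hd : d ∣ m) (hne : d ≠ m) :
    ∃ q, q.Prime ∧ q ∣ m ∧ d ∣ m / q := by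
  obtain ⟨k, rfl⟩ := hd
  have hk : k ≠ 1 := by
    rintro rfl
    simp at hne
  obtain ⟨q, hq, c, rfl⟩ := Nat.exists_prime_and_dvd hk
  refine ⟨q, hq, ⟨d * c, by ring⟩, c, ?_⟩
  rw [mul_left_comm, Nat.mul_div_cancel_left _ hq.pos]

/-- If `f : ℕ → Finset α` satisfies `f (gcd a b) = f a ∩ f b` for all
`a, b ≥ 1`, then for every `n ≥ 1`,
`f (n+1) ∩ (⋃_{i=1}^{n} f i) = ⋃_{q prime, q ∣ n+1} f ((n+1)/q)`. -/
theorem inter_biUnion_eq_biUnion_primeFactors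
    {α : Type*} [DecidableEq α] (f : ℕ → Finset α)
    (hf : ∀ a b : ℕ, 1 ≤ a → 1 ≤ b → f (Nat.gcd a b) = f a ∩ f b)
    (n : ℕ) (hn : 1 ≤ n) :
    f (n + 1) ∩ (Finset.Icc 1 n).biUnion f =
      (n + 1).primeFactors.biUnion fun q => f ((n + 1) / q) := by
  ext x
  simp only [Finset.mem_inter, Finset.mem_biUnion, Finset.mem_Icc, Nat.mem_primeFactors]
  constructor
  · rintro ⟨hx, i, ⟨hi, hin⟩, hxi⟩
    have hxg : x ∈ f (Nat.gcd (n + 1) i) := by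
      rw [hf _ _ n.succ_pos hi]
      exact Finset.mem_inter.mpr ⟨hx, hxi⟩
    have hle : Nat.gcd (n + 1) i ≤ i := Nat.gcd_le_right _ hi
    obtain ⟨q, hq, hqn, hgq⟩ :=
      exists_prime_dvd_and_dvd_div (Nat.gcd_dvd_left (n + 1) i) (by omega)
    have hpos : 1 ≤ (n + 1) / q := Nat.div_pos (Nat.le_of_dvd n.succ_pos hqn) hq.pos
    exact ⟨q, ⟨hq, hqn, n.succ_ne_zero⟩, subset_of_dvd_of_map_gcd hf hpos hgq hxg⟩
  · rintro ⟨q, ⟨hq, hqn, -⟩, hx⟩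
    have hpos : 1 ≤ (n + 1) / q := Nat.div_pos (Nat.le_of_dvd n.succ_pos hqn) hq.pos
    have hlt : (n + 1) / q < n + 1 := Nat.div_lt_self n.succ_pos hq.one_lt
    exact ⟨subset_of_dvd_of_map_gcd hf n.succ_pos (Nat.div_dvd_of_dvd hqn) hx,
      (n + 1) / q, ⟨hpos, Nat.le_of_lt_succ hlt⟩, hx⟩
end
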